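/- Let X and Y be Banach spaces with Y continuously embedded in X, let G generate a C₀-semigroup (S(t))_{t≥0} on X leaving Y invariant with t ↦ S(t)y continuous into Y, with M := sup_{t∈[0,s₁]}‖S(t)|_Y‖_{B(Y)} < ∞. Assume there is an increasing function η : (0,∞) → (0,∞) with η(δ) → 0 as δ → 0⁺ such that for all 0 ≤ s₀ < s₁ and φ ∈ C([s₀,s₁],X), ∫_{s₀}^{s₁} S(s₁−s)φ(s) ds ∈ Y with ‖∫_{s₀}^{s₁} S(s₁−s)φ(s) ds‖_Y ≤ η(s₁−s₀)‖φ‖_{C([s₀,s₁],X)}. Then for any φ ∈ C([s₀,s₁],X), the map t ↦ ∫_{s₀}^t S(t−s)φ(s) ds is continuous from [s₀,s₁] into Y. -/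

import Mathlib

/-- A strongly continuous family of operators on `[0, ∞)` is uniformly bounded on compact
intervals. -/
theorem exists_lipschitz_bound_of_strongly_continuous
    {X : Type*} [NormedAddCommGroup X] [NormedSpace ℝ X] [CompleteSpace X]
    {S : ℝ → X →L[ℝ] X} (hS : ∀ x : X, ContinuousOn (fun t => S t x) (Set.Ici 0)) (T : ℝ) :
    ∃ N : NNReal, ∀ t ∈ Set.Icc 0 T, LipschitzWith N (S t) := by
  obtain ⟨N, hN⟩ := banach_steinhaus (g := fun t : Set.Icc (0 : ℝ) T => S t) (fun x => by
    obtain ⟨C, hC⟩ := isCompact_Icc.exists_bound_of_continuousOn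
      ((hS x).mono (Set.Icc_subset_Ici_self : Set.Icc 0 T ⊆ _))
    exact ⟨C, fun t => hC t t.2⟩)
  refine ⟨N.toNNReal, fun t ht => (S t).lipschitz.weaken ?_⟩
  rw [← NNReal.coe_le_coe, coe_nnnorm]
  exact (hN ⟨t, ht⟩).trans (Real.le_coe_toNNReal N)

/-- The integrand of a convolution with a strongly continuous family is continuous. -/
theorem continuousOn_convolution_integrand
    {X : Type*} [NormedAddCommGroup X] [NormedSpace ℝ X] [CompleteSpace X]
    {S : ℝ → X →L[ℝ] X} (hS : ∀ x : X, ContinuousOn (fun t => S t x) (Set.Ici 0))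
    {a b : ℝ} {ψ : ℝ → X} (hψ : ContinuousOn ψ (Set.Icc a b)) :
    ContinuousOn (fun s => S (b - s) (ψ s)) (Set.Icc a b) := by
  obtain ⟨N, hN⟩ := exists_lipschitz_bound_of_strongly_continuous hS (b - a)
  have hjoint : ContinuousOn (fun p : X × ℝ => S p.2 p.1)
      (Set.univ ×ˢ Set.Icc 0 (b - a)) :=
    continuousOn_prod_of_continuousOn_lipschitzOnWith _ N
      (fun x _ => (hS x).mono Set.Icc_subset_Ici_self)
      (fun t ht => (hN t ht).lipschitzOnWith)
  refine hjoint.comp (f := fun s => (ψ s, b - s)) (hψ.prodMk (by fun_prop)) fun s hs => ?_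
  exact ⟨Set.mem_univ _, by linarith [hs.2], by linarith [hs.1]⟩

/-- The increment of the convolution, for a semigroup `S`, between the times `t` and `t + h`. -/
theorem integral_convolution_add_sub
    {X : Type*} [NormedAddCommGroup X] [NormedSpace ℝ X] [CompleteSpace X]
    {S : ℝ → X →L[ℝ] X} (hSadd : ∀ s t : ℝ, 0 ≤ s → 0 ≤ t → S (s + t) = (S s).comp (S t))
    (hS : ∀ x : X, ContinuousOn (fun t => S t x) (Set.Ici 0))
    {a t h : ℝ} (hat : a ≤ t) (hh : 0 ≤ h) {φ : ℝ → X}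
    (hφ : ContinuousOn φ (Set.Icc a (t + h))) :
    (∫ s in a..(t + h), S (t + h - s) (φ s)) - ∫ s in a..t, S (t - s) (φ s) =
      S (t - a) (∫ s in a..(a + h), S (a + h - s) (φ s)) +
        ∫ s in a..t, S (t - s) (φ (s + h) - φ s) := by
  have hcont := continuousOn_convolution_integrand hS hφ
  have hφh : ContinuousOn (fun s => φ (s + h)) (Set.Icc a t) :=
    hφ.comp (by fun_prop) fun s hs => ⟨by linarith [hs.1], by linarith [hs.2]⟩
  have hφt : ContinuousOn φ (Set.Icc a t) :=
    hφ.mono (Set.Icc_subset_Icc_right (by linarith))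
  have hφa : ContinuousOn φ (Set.Icc a (a + h)) :=
    hφ.mono (Set.Icc_subset_Icc_right (by linarith))
  have hsplit := intervalIntegral.integral_add_adjacent_intervals
    ((hcont.mono (Set.Icc_subset_Icc_right (by linarith : a + h ≤ t + h))
      ).intervalIntegrable_of_Icc (μ := MeasureTheory.volume) (by linarith))
    ((hcont.mono (Set.Icc_subset_Icc_left (by linarith : a ≤ a + h))
      ).intervalIntegrable_of_Icc (μ := MeasureTheory.volume) (by linarith))
  have hfirst : ∫ s in a..(a + h), S (t + h - s) (φ s) =
      S (t - a) (∫ s in a..(a + h), S (a + h - s) (φ s)) := by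
    rw [← ContinuousLinearMap.intervalIntegral_comp_comm _
      ((continuousOn_convolution_integrand hS hφa).intervalIntegrable_of_Icc (by linarith))]
    refine intervalIntegral.integral_congr fun s hs => ?_
    rw [Set.uIcc_of_le (by linarith)] at hs
    have hst : t + h - s = (t - a) + (a + h - s) := by ring
    simp only [hst]
    rw [hSadd _ _ (by linarith) (by linarith [hs.2])]
    rfl
  have hsecond : ∫ s in (a + h)..(t + h), S (t + h - s) (φ s) =
      ∫ s in a..t, S (t - s) (φ (s + h)) := by
    rw [← intervalIntegral.integral_comp_add_right (fun s => S (t + h - s) (φ s))]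
    simp only [add_sub_add_right_eq_sub]
  simp only [map_sub]
  rw [intervalIntegral.integral_sub
    ((continuousOn_convolution_integrand hS hφh).intervalIntegrable_of_Icc hat)
    ((continuousOn_convolution_integrand hS hφt).intervalIntegrable_of_Icc hat),
    ← hsplit, hfirst, hsecond]
  abel

theorem stmt_13
    {X Y : Type*}
    [NormedAddCommGroup X] [NormedSpace ℝ X] [CompleteSpace X]
    [NormedAddCommGroup Y] [NormedSpace ℝ Y] [CompleteSpace Y]
    (j : Y →L[ℝ] X) (hjinj : Function.Injective j)
    (S : ℝ → X →L[ℝ] X)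
    (hS0 : S 0 = ContinuousLinearMap.id ℝ X)
    (hSadd : ∀ s t : ℝ, 0 ≤ s → 0 ≤ t → S (s + t) = (S s).comp (S t))
    (hScont : ∀ x : X, ContinuousOn (fun t => S t x) (Set.Ici 0))
    (SY : ℝ → Y →L[ℝ] Y)
    (hSY : ∀ t : ℝ, 0 ≤ t → ∀ y : Y, j (SY t y) = S t (j y))
    (hSYcont : ∀ y : Y, ContinuousOn (fun t => SY t y) (Set.Ici 0))
    (s₀ s₁ : ℝ) (hs : 0 ≤ s₀) (hs' : s₀ < s₁)
    (M : ℝ) (hM : ∀ t ∈ Set.Icc (0:ℝ) s₁, ‖SY t‖ ≤ M)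
    (η : ℝ → ℝ)
    (hηpos : ∀ δ > (0:ℝ), 0 < η δ)
    (hηmono : MonotoneOn η (Set.Ioi 0))
    (hη0 : Filter.Tendsto η (nhdsWithin 0 (Set.Ioi 0)) (nhds 0))
    (hconv : ∀ a b : ℝ, 0 ≤ a → a < b → ∀ ψ : ℝ → X, ContinuousOn ψ (Set.Icc a b) →
      ∃ v : Y, j v = ∫ s in a..b, S (b - s) (ψ s) ∧
        ∀ C : ℝ, (∀ s ∈ Set.Icc a b, ‖ψ s‖ ≤ C) → ‖v‖ ≤ η (b - a) * C)
    (φ : ℝ → X) (hφ : ContinuousOn φ (Set.Icc s₀ s₁)) :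
    ∃ u : ℝ → Y, ContinuousOn u (Set.Icc s₀ s₁) ∧
      ∀ t ∈ Set.Icc s₀ s₁, j (u t) = ∫ s in s₀..t, S (t - s) (φ s) := by
  have hbound : ∀ a b D C : ℝ, 0 ≤ a → a ≤ b → 0 < D → b - a ≤ D → ∀ ψ : ℝ → X,
      ContinuousOn ψ (Set.Icc a b) → (∀ s ∈ Set.Icc a b, ‖ψ s‖ ≤ C) →
      ∃ v : Y, j v = ∫ s in a..b, S (b - s) (ψ s) ∧ ‖v‖ ≤ η D * C := by
    intro a b D C ha hab hD hbD ψ hψ hC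
    have hC0 : 0 ≤ C := (norm_nonneg _).trans (hC a ⟨le_rfl, hab⟩)
    rcases hab.eq_or_lt with rfl | hab
    · exact ⟨0, by simp, by simpa using mul_nonneg (hηpos D hD).le hC0⟩
    · obtain ⟨v, hv, hvC⟩ := hconv a b ha hab ψ hψ
      exact ⟨v, hv, (hvC C hC).trans
        (mul_le_mul_of_nonneg_right (hηmono (sub_pos.2 hab) hD hbD) hC0)⟩
  obtain ⟨K, hK⟩ := isCompact_Icc.exists_bound_of_continuousOn hφ
  have hK0 : 0 ≤ K := (norm_nonneg _).trans (hK s₀ ⟨le_rfl, hs'.le⟩)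
  have hM0 : 0 ≤ M := (norm_nonneg _).trans (hM 0 ⟨le_rfl, by linarith⟩)
  have hex : ∀ t : ℝ, ∃ v : Y, t ∈ Set.Icc s₀ s₁ → j v = ∫ s in s₀..t, S (t - s) (φ s) := by
    intro t
    by_cases ht : t ∈ Set.Icc s₀ s₁
    · have hsub : Set.Icc s₀ t ⊆ Set.Icc s₀ s₁ := Set.Icc_subset_Icc_right ht.2
      obtain ⟨v, hv, -⟩ := hbound s₀ t (s₁ - s₀) K hs ht.1 (by linarith) (by linarith [ht.2]) φ
        (hφ.mono hsub) (fun s hst => hK s (hsub hst))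
      exact ⟨v, fun _ => hv⟩
    · exact ⟨0, fun h => absurd h ht⟩
  choose u hu using hex
  refine ⟨u, ?_, hu⟩
  have hL : 0 < η (s₁ - s₀) := hηpos _ (by linarith)
  have hmod : ∀ ε > 0, ∃ δ > 0, ∀ t ∈ Set.Icc s₀ s₁, ∀ t' ∈ Set.Icc s₀ s₁, t ≤ t' → t' - t < δ →
      ‖u t' - u t‖ < ε := by
    intro ε hε
    have hη0' : Filter.Tendsto (fun δ => M * (η δ * K)) (nhdsWithin 0 (Set.Ioi 0)) (nhds 0) := by
      simpa using (hη0.mul_const K).const_mul M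
    obtain ⟨D, hDε, hD⟩ := ((hη0'.eventually (gt_mem_nhds (half_pos hε))).and
      self_mem_nhdsWithin).exists
    have hD : 0 < D := hD
    obtain ⟨ρ, hρ, hφρ⟩ := Metric.uniformContinuousOn_iff.1
      (isCompact_Icc.uniformContinuousOn_of_continuous hφ) (ε / 2 / η (s₁ - s₀)) (by positivity)
    refine ⟨min D ρ, lt_min hD hρ, fun t ht t' ht' htt' hδ => ?_⟩
    obtain ⟨h, rfl⟩ : ∃ h, t' = t + h := ⟨t' - t, by ring⟩
    have hh : 0 ≤ h := by linarith
    have hhD : h < D := by linarith [hδ.trans_le (min_le_left D ρ)]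
    have hhρ : h < ρ := by linarith [hδ.trans_le (min_le_right D ρ)]
    have hsub : Set.Icc s₀ (s₀ + h) ⊆ Set.Icc s₀ s₁ :=
      Set.Icc_subset_Icc_right (by linarith [ht.1, ht'.2])
    obtain ⟨v, hv, hvK⟩ := hbound s₀ (s₀ + h) D K hs (by linarith) hD (by linarith) φ
      (hφ.mono hsub) (fun s hst => hK s (hsub hst))
    have hmem : ∀ s ∈ Set.Icc s₀ t, s ∈ Set.Icc s₀ s₁ ∧ s + h ∈ Set.Icc s₀ s₁ := fun s hst =>
      ⟨⟨hst.1, hst.2.trans ht.2⟩, by linarith [hst.1], by linarith [hst.2, ht'.2]⟩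
    obtain ⟨w, hw, hwε⟩ := hbound s₀ t (s₁ - s₀) (ε / 2 / η (s₁ - s₀)) hs ht.1 (by linarith)
      (by linarith [ht.2]) (fun s => φ (s + h) - φ s)
      ((hφ.comp (by fun_prop) fun s hst => (hmem s hst).2).sub
        (hφ.mono fun s hst => (hmem s hst).1))
      (fun s hst => by
        rw [← dist_eq_norm]
        exact (hφρ _ (hmem s hst).2 _ (hmem s hst).1
          (by simpa [Real.dist_eq, abs_of_nonneg hh] using hhρ)).le)
    have huvw : u (t + h) - u t = SY (t - s₀) v + w := by
      apply hjinj
      rw [map_sub, map_add, hu _ ht', hu _ ht, hSY _ (by linarith [ht.1]), hv, hw]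
      exact integral_convolution_add_sub hSadd hScont ht.1 hh
        (hφ.mono (Set.Icc_subset_Icc_right ht'.2))
    have hSv : ‖SY (t - s₀) v‖ ≤ M * (η D * K) :=
      (SY (t - s₀)).le_of_opNorm_le_of_le (hM _ ⟨by linarith [ht.1], by linarith [ht.2]⟩) hvK
    rw [mul_div_cancel₀ _ hL.ne'] at hwε
    rw [huvw]
    linarith [norm_add_le (SY (t - s₀) v) w]
  refine Metric.continuousOn_iff.2 fun t ht ε hε => ?_
  obtain ⟨δ, hδ, hδε⟩ := hmod ε hε
  refine ⟨δ, hδ, fun t' ht' hd => ?_⟩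
  rw [Real.dist_eq, abs_lt] at hd
  rcases le_total t t' with h | h
  · rw [dist_eq_norm]
    exact hδε t ht t' ht' h (by linarith)
  · rw [dist_comm, dist_eq_norm]
    exact hδε t' ht' t ht h (by linarith)
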